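/- arXiv:1701.03560 — 3 statements merged into one kernel-verified Lean document; each statement's English description precedes it below -/
import Mathlib

section
/- The function μ(l) = (√(d² + 4l²) − d)/(2l) = 2l/(√(d² + 4l²) + d), extended by μ(0) = 0, satisfies the strict differential inequality μ'(l) < 1 − ((d−1)/l) μ(l) − μ(l)² for all l > 0. -/
open Real

/-- The function `μ(l) = 2l/(√(d²+4l²)+d)` satisfies the strict differential inequality
`μ'(l) < 1 − ((d−1)/l) μ(l) − μ(l)²` for all `l > 0`. -/
theorem mu_strict_subsolution (d : ℕ) (hd : 2 ≤ d) (μ : ℝ → ℝ)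
    (hμ : ∀ l : ℝ, μ l = 2 * l / (Real.sqrt ((d : ℝ) ^ 2 + 4 * l ^ 2) + d)) :
    ∀ l : ℝ, 0 < l →
      deriv μ l < 1 - (((d : ℝ) - 1) / l) * μ l - (μ l) ^ 2 := by
  intro l hl
  have hd0 : (0 : ℝ) < d := by
    have : 0 < d := by omega
    exact_mod_cast this
  have hpos : (0 : ℝ) < (d : ℝ) ^ 2 + 4 * l ^ 2 := by positivity
  have hin : HasDerivAt (fun x : ℝ => (d : ℝ) ^ 2 + 4 * x ^ 2) (8 * l) l := by
    have h := ((hasDerivAt_pow 2 l).const_mul 4).const_add ((d : ℝ) ^ 2)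
    refine h.congr_deriv ?_
    norm_num
    ring
  have hs := (hin.sqrt hpos.ne').add_const (d : ℝ)
  have hnum : HasDerivAt (fun x : ℝ => 2 * x) 2 l := by
    simpa using (hasDerivAt_id l).const_mul (2 : ℝ)
  have hne : Real.sqrt ((d : ℝ) ^ 2 + 4 * l ^ 2) + d ≠ 0 := by positivity
  have hD := hnum.fun_div hs hne
  have hfun : μ = fun x : ℝ => 2 * x / (Real.sqrt ((d : ℝ) ^ 2 + 4 * x ^ 2) + d) := funext hμ
  rw [hμ l, hfun, hD.deriv]
  have hsq := Real.sq_sqrt hpos.le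
  have hs0 := Real.sqrt_pos.mpr hpos
  generalize Real.sqrt ((d : ℝ) ^ 2 + 4 * l ^ 2) = s at *
  have hds : (d : ℝ) < s := by nlinarith
  have e1 : (2 * (s + d) - 2 * l * (8 * l / (2 * s))) / (s + d) ^ 2
      = 2 * d / (s * (s + d)) := by
    field_simp
    linear_combination 2 * hsq
  have e2 : 1 - ((d : ℝ) - 1) / l * (2 * l / (s + d)) - (2 * l / (s + d)) ^ 2
      = 2 / (s + d) := by
    field_simp
    linear_combination hsq
  rw [e1, e2, div_lt_div_iff₀ (by positivity) (by positivity)]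
  have : 0 < s + d := by positivity
  nlinarith [mul_pos this (sub_pos.mpr hds)]
end

section
/- (Integration by parts on spheres) Let A be a C¹ vector field on the annulus O = {v ∈ ℝ^d : r₁ < |v| < r₂}. Then for every t ∈ (r₁, r₂): ∫_{|ω|=t} (div A)(ω) dω = ∫_{|ω|=t} [ (ω⊗ω/t²) : ∂A(ω) + ((d−1)/t²) ω·A(ω) ] dω. -/
open Real MeasureTheory RealInnerProductSpace

section SphereHelpers

variable {E : Type*} [NormedAddCommGroup E] [InnerProductSpace ℝ E] [FiniteDimensional ℝ E]
  [MeasurableSpace E] [BorelSpace E]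

open Topology in
/-- If the sphere had infinite measure, continuous functions would integrate to (junk) zero. -/
theorem sphere_integral_zero_of_infinite (s t : ℝ) (f : E → ℝ)
    (hf : ContinuousOn f (Metric.sphere 0 t))
    (hinf : ¬ (μH[s] (Metric.sphere (0 : E) t) < ⊤)) :
    ∫ x in Metric.sphere (0 : E) t, f x ∂μH[s] = 0 := by
  by_contra hne
  apply hinf
  have hint : IntegrableOn f (Metric.sphere (0 : E) t) μH[s] := by
    by_contra h
    exact hne (integral_undef h)
  obtain ⟨x0, hx0, hfx0⟩ : ∃ x ∈ Metric.sphere (0 : E) t, f x ≠ 0 := by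
    by_contra! h
    exact hne (setIntegral_eq_zero_of_forall_eq_zero h)
  have hpos : 0 < ‖f x0‖ / 2 := by positivity
  have hfin := hint.measure_norm_gt_lt_top hpos
  have hfin2 := (Measure.le_restrict_apply _ _).trans_lt hfin
  have hU : ({a | ‖f x0‖ / 2 < ‖f a‖} ∩ Metric.sphere (0 : E) t) ∈
      𝓝[Metric.sphere (0 : E) t] x0 := by
    refine Filter.inter_mem ?_ self_mem_nhdsWithin
    exact (hf x0 hx0).norm.eventually (lt_mem_nhds (by linarith))
  refine (isCompact_sphere (0 : E) t).measure_lt_top_of_nhdsWithin fun y hy => ?_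
  have hn : ‖y‖ = ‖x0‖ := by
    rw [mem_sphere_zero_iff_norm] at hy hx0
    rw [hy, hx0]
  set R : E ≃ₗᵢ[ℝ] E := Submodule.reflection (Submodule.span ℝ {y - x0})ᗮ with hR
  have hRy : R y = x0 := Submodule.reflection_sub hn
  refine ⟨R.toIsometryEquiv ⁻¹' ({a | ‖f x0‖ / 2 < ‖f a‖} ∩ Metric.sphere (0 : E) t), ?_, ?_⟩
  · have hc : Filter.Tendsto R (𝓝[Metric.sphere (0 : E) t] y)
        (𝓝[Metric.sphere (0 : E) t] x0) := by
      rw [← hRy]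
      refine R.continuous.continuousWithinAt.tendsto_nhdsWithin fun z hz => ?_
      simpa using hz
    exact hc hU
  · rw [IsometryEquiv.hausdorffMeasure_preimage]
    exact hfin2

/-- Norm preservation of the flow of a skew map. -/
theorem norm_exp_skew (J : E →L[ℝ] E) (hJ : ∀ x, ⟪J x, x⟫ = 0) (θ : ℝ) (x : E) :
    ‖NormedSpace.exp (θ • J) x‖ = ‖x‖ := by
  have hd : ∀ u : ℝ, HasDerivAt (fun u : ℝ => NormedSpace.exp (u • J) x)
      (J (NormedSpace.exp (u • J) x)) u := fun u => by
    simpa using (hasDerivAt_exp_smul_const' (𝕂 := ℝ) J u).clm_apply (hasDerivAt_const u x)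
  have hn : ∀ u : ℝ, HasDerivAt (fun u : ℝ => ‖NormedSpace.exp (u • J) x‖ ^ 2) 0 u := fun u => by
    have := (hd u).norm_sq
    rwa [real_inner_comm, hJ, mul_zero] at this
  have hc := is_const_of_deriv_eq_zero (fun u => (hn u).differentiableAt)
    (fun u => (hn u).deriv) θ 0
  simp only [zero_smul, NormedSpace.exp_zero, ContinuousLinearMap.one_apply] at hc
  exact (sq_eq_sq₀ (norm_nonneg _) (norm_nonneg _)).1 hc

open Topology in
/-- Rotation invariance: the derivative along a rotation field integrates to zero. -/
theorem sphere_integral_rotation (s t : ℝ) (O : Set E) (hO : IsOpen O)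
    (hSO : Metric.sphere 0 t ⊆ O) (f : E → ℝ) (hf : ContDiffOn ℝ 1 f O)
    (J : E →L[ℝ] E) (hJ : ∀ x, ⟪J x, x⟫ = 0)
    (hfin : μH[s] (Metric.sphere (0 : E) t) < ⊤) :
    ∫ x in Metric.sphere (0 : E) t, fderiv ℝ f x (J x) ∂μH[s] = 0 := by
  set S := Metric.sphere (0 : E) t with hS
  have hK : IsCompact S := isCompact_sphere _ _
  have hSm : MeasurableSet S := hK.measurableSet
  have hd : ∀ (x : E) (u : ℝ), HasDerivAt (fun u : ℝ => NormedSpace.exp (u • J) x)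
      (J (NormedSpace.exp (u • J) x)) u := fun x u => by
    simpa using (hasDerivAt_exp_smul_const' (𝕂 := ℝ) J u).clm_apply (hasDerivAt_const u x)
  have hmem : ∀ (u : ℝ) (x : E), x ∈ S → NormedSpace.exp (u • J) x ∈ S := fun u x hx => by
    rw [hS, mem_sphere_zero_iff_norm] at hx ⊢
    rw [norm_exp_skew J hJ, hx]
  have hfc : ContinuousOn f S := hf.continuousOn.mono hSO
  have hgc : ContinuousOn (fun x => fderiv ℝ f x (J x)) S :=
    ((hf.continuousOn_fderiv_of_isOpen hO le_rfl).mono hSO).clm_apply J.continuous.continuousOn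
  obtain ⟨C, hC⟩ := hK.exists_bound_of_continuousOn hgc
  have hcomp : ∀ {h : E → ℝ}, ContinuousOn h S → ∀ u : ℝ,
      IntegrableOn (fun x => h (NormedSpace.exp (u • J) x)) S μH[s] := fun {h} hh u =>
    (hh.comp (NormedSpace.exp (u • J)).continuous.continuousOn
      (hmem u)).integrableOn_of_subset_isCompact hK hSm le_rfl hfin.ne
  have key := (hasDerivAt_integral_of_dominated_loc_of_deriv_le
    (μ := μH[s].restrict S) (x₀ := (0 : ℝ)) (s := Set.univ) (bound := fun _ => C)
    (F := fun u x => f (NormedSpace.exp (u • J) x))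
    (F' := fun u x => fderiv ℝ f (NormedSpace.exp (u • J) x) (J (NormedSpace.exp (u • J) x)))
    Filter.univ_mem
    (Filter.Eventually.of_forall fun u => (hcomp hfc u).aestronglyMeasurable)
    (hcomp hfc 0) (hcomp hgc 0).aestronglyMeasurable
    ((ae_restrict_mem hSm).mono fun x hx u _ => hC _ (hmem u x hx))
    (integrableOn_const hfin.ne)
    ((ae_restrict_mem hSm).mono fun x hx u _ => by
      have h1 : HasFDerivAt f (fderiv ℝ f (NormedSpace.exp (u • J) x))
          (NormedSpace.exp (u • J) x) :=
        ((hf.differentiableOn one_ne_zero).differentiableAt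
          (hO.mem_nhds (hSO (hmem u x hx)))).hasFDerivAt
      exact h1.comp_hasDerivAt u (hd x u))).2
  have hconst : ∀ u : ℝ, ∫ x in S, f (NormedSpace.exp (u • J) x) ∂μH[s]
      = ∫ x in S, f x ∂μH[s] := fun u => by
    let L : E →ₗᵢ[ℝ] E := ⟨(NormedSpace.exp (u • J) : E →L[ℝ] E).toLinearMap,
      norm_exp_skew J hJ u⟩
    let e : E ≃ₗᵢ[ℝ] E := L.toLinearIsometryEquiv rfl
    have he : ∀ x, e x = NormedSpace.exp (u • J) x := fun x => rfl
    have hp : e ⁻¹' S = S := by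
      ext x
      simp [hS]
    have := (e.toIsometryEquiv.measurePreserving_hausdorffMeasure s).setIntegral_preimage_emb
      e.toHomeomorph.measurableEmbedding f S
    have h2 : (e.toIsometryEquiv ⁻¹' S) = S := hp
    rw [h2] at this
    exact this
  simp only [hconst] at key
  have := key.unique (hasDerivAt_const _ _)
  simpa using this

end SphereHelpers

/-- The generator of rotations in the plane spanned by the `i`-th and `j`-th basis vectors. -/
noncomputable def rotGen {d : ℕ} (i j : Fin d) :
    EuclideanSpace ℝ (Fin d) →L[ℝ] EuclideanSpace ℝ (Fin d) :=
  (EuclideanSpace.proj i : EuclideanSpace ℝ (Fin d) →L[ℝ] ℝ).smulRight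
      (EuclideanSpace.single j (1 : ℝ)) -
    (EuclideanSpace.proj j : EuclideanSpace ℝ (Fin d) →L[ℝ] ℝ).smulRight
      (EuclideanSpace.single i (1 : ℝ))

theorem rotGen_apply {d : ℕ} (i j : Fin d) (x : EuclideanSpace ℝ (Fin d)) :
    rotGen i j x = x i • EuclideanSpace.single j (1 : ℝ)
      - x j • EuclideanSpace.single i (1 : ℝ) := by
  simp [rotGen]

theorem rotGen_skew {d : ℕ} (i j : Fin d) (x : EuclideanSpace ℝ (Fin d)) :
    ⟪rotGen i j x, x⟫ = 0 := by
  rw [rotGen_apply, inner_sub_left, inner_smul_left, inner_smul_left]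
  simp [EuclideanSpace.inner_single_left]
  ring

/-- The pointwise algebraic identity. -/
theorem rot_sum_identity {d : ℕ} (x a : EuclideanSpace ℝ (Fin d))
    (D : EuclideanSpace ℝ (Fin d) →L[ℝ] EuclideanSpace ℝ (Fin d)) :
    ∑ i : Fin d, ∑ j : Fin d, (x i * D (rotGen i j x) j + rotGen i j x i * a j)
      = ‖x‖ ^ 2 * (∑ i : Fin d, D (EuclideanSpace.single i 1) i) - ⟪x, D x⟫
        - ((d : ℝ) - 1) * ⟪x, a⟫ := by
  have hx : x = ∑ i, x i • EuclideanSpace.single i (1 : ℝ) := by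
    ext k
    simp [Finset.sum_apply, Pi.single_apply]
  have hD : ∀ j, D x j = ∑ i, x i * D (EuclideanSpace.single i 1) j := fun j => by
    conv_lhs => rw [hx, map_sum]
    simp
  have e1 : ‖x‖ ^ 2 = ∑ i, x i * x i := by
    rw [EuclideanSpace.real_norm_sq_eq]
    exact Finset.sum_congr rfl fun i _ => sq _
  have e2 : ⟪x, D x⟫ = ∑ i, ∑ j, x i * (x j * D (EuclideanSpace.single i 1) j) := by
    rw [Finset.sum_comm, PiLp.inner_apply]
    refine Finset.sum_congr rfl fun j _ => ?_
    rw [hD]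
    simp only [RCLike.inner_apply, conj_trivial, Finset.sum_mul]
    exact Finset.sum_congr rfl fun i _ => by ring
  have e3 : ⟪x, a⟫ = ∑ j, x j * a j := by
    rw [PiLp.inner_apply]
    exact Finset.sum_congr rfl fun i _ => by simp [mul_comm]
  have hterm : ∀ i j, x i * D (rotGen i j x) j + rotGen i j x i * a j
      = x i * x i * D (EuclideanSpace.single j 1) j
        - x i * (x j * D (EuclideanSpace.single i 1) j)
        + ((if i = j then x j * a j else 0) - x j * a j) := fun i j => by
    rw [rotGen_apply]
    by_cases h : i = j
    · subst h
      simp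
      ring
    · simp [h, Pi.single_apply]
      ring
  simp only [hterm, Finset.sum_add_distrib, Finset.sum_sub_distrib]
  rw [e1, e2, e3, Finset.sum_mul_sum]
  simp
  ring

/-- Integration by parts on spheres: for a `C¹` vector field `A` on the annulus
`O = {r₁ < |v| < r₂}` in `ℝ^d` and every `t ∈ (r₁, r₂)`,
`∫_{|ω|=t} div A dω = ∫_{|ω|=t} [(ω⊗ω/t²) : ∂A(ω) + ((d−1)/t²) ω·A(ω)] dω`. -/
theorem integration_by_parts_sphere (d : ℕ) (hd : 2 ≤ d) (r₁ r₂ : ℝ) (h12 : 0 < r₁)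
    (hlt : r₁ < r₂)
    (A : EuclideanSpace ℝ (Fin d) → EuclideanSpace ℝ (Fin d))
    (hA : ContDiffOn ℝ 1 A {v : EuclideanSpace ℝ (Fin d) | r₁ < ‖v‖ ∧ ‖v‖ < r₂}) :
    ∀ t ∈ Set.Ioo r₁ r₂,
      (∫ ω in Metric.sphere (0 : EuclideanSpace ℝ (Fin d)) t,
          (∑ i : Fin d, fderiv ℝ A ω (EuclideanSpace.single i 1) i)
          ∂(μH[(d : ℝ) - 1])) =
      ∫ ω in Metric.sphere (0 : EuclideanSpace ℝ (Fin d)) t,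
          ((1 / t ^ 2) * ⟪ω, fderiv ℝ A ω ω⟫ + (((d : ℝ) - 1) / t ^ 2) * ⟪ω, A ω⟫)
          ∂(μH[(d : ℝ) - 1]) := by
  intro t ht
  have ht0 : 0 < t := h12.trans ht.1
  set O : Set (EuclideanSpace ℝ (Fin d)) := {v | r₁ < ‖v‖ ∧ ‖v‖ < r₂} with hOdef
  have hO : IsOpen O :=
    (isOpen_lt continuous_const continuous_norm).inter (isOpen_lt continuous_norm continuous_const)
  have hSO : Metric.sphere (0 : EuclideanSpace ℝ (Fin d)) t ⊆ O := fun x hx => by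
    rw [mem_sphere_zero_iff_norm] at hx
    exact ⟨hx ▸ ht.1, hx ▸ ht.2⟩
  have hK : IsCompact (Metric.sphere (0 : EuclideanSpace ℝ (Fin d)) t) := isCompact_sphere _ _
  have hAc : ContinuousOn A (Metric.sphere 0 t) := hA.continuousOn.mono hSO
  have hDc : ContinuousOn (fderiv ℝ A) (Metric.sphere 0 t) :=
    (hA.continuousOn_fderiv_of_isOpen hO le_rfl).mono hSO
  have hproj : ∀ {F : EuclideanSpace ℝ (Fin d) → EuclideanSpace ℝ (Fin d)}
      {S : Set (EuclideanSpace ℝ (Fin d))} (j : Fin d), ContinuousOn F S →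
      ContinuousOn (fun x => F x j) S := fun {F S} j hF =>
    (EuclideanSpace.proj j : EuclideanSpace ℝ (Fin d) →L[ℝ] ℝ).continuous.comp_continuousOn hF
  have hLc : ContinuousOn (fun ω => ∑ i : Fin d, fderiv ℝ A ω (EuclideanSpace.single i 1) i)
      (Metric.sphere 0 t) :=
    continuousOn_finset_sum _ fun i _ => hproj i (hDc.clm_apply continuousOn_const)
  have hRc : ContinuousOn (fun ω : EuclideanSpace ℝ (Fin d) =>
      (1 / t ^ 2) * ⟪ω, fderiv ℝ A ω ω⟫ + (((d : ℝ) - 1) / t ^ 2) * ⟪ω, A ω⟫)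
      (Metric.sphere 0 t) :=
    (continuousOn_const.mul (continuousOn_id.inner (𝕜 := ℝ) (hDc.clm_apply continuousOn_id))).add
      (continuousOn_const.mul (continuousOn_id.inner (𝕜 := ℝ) hAc))
  by_cases hfin : μH[(d : ℝ) - 1] (Metric.sphere (0 : EuclideanSpace ℝ (Fin d)) t) < ⊤
  swap
  · rw [sphere_integral_zero_of_infinite _ t _ hLc hfin,
      sphere_integral_zero_of_infinite _ t _ hRc hfin]
  have hint : ∀ {h : EuclideanSpace ℝ (Fin d) → ℝ}, ContinuousOn h (Metric.sphere 0 t) →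
      IntegrableOn h (Metric.sphere 0 t) μH[(d : ℝ) - 1] := fun {h} hh =>
    hh.integrableOn_of_subset_isCompact hK hK.measurableSet le_rfl hfin.ne
  rw [← sub_eq_zero, ← integral_sub (hint hLc) (hint hRc)]
  have hfd : ∀ i j : Fin d, ∀ x ∈ Metric.sphere (0 : EuclideanSpace ℝ (Fin d)) t,
      fderiv ℝ (fun y : EuclideanSpace ℝ (Fin d) => y i * A y j) x (rotGen i j x)
      = x i * fderiv ℝ A x (rotGen i j x) j + rotGen i j x i * A x j := fun i j x hx => by
    have h1 : HasFDerivAt A (fderiv ℝ A x) x :=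
      ((hA.differentiableOn one_ne_zero).differentiableAt (hO.mem_nhds (hSO hx))).hasFDerivAt
    have h2 := (EuclideanSpace.proj j : EuclideanSpace ℝ (Fin d) →L[ℝ] ℝ).hasFDerivAt.comp x h1
    have h3 := (EuclideanSpace.proj i : EuclideanSpace ℝ (Fin d) →L[ℝ] ℝ).hasFDerivAt (x := x)
    have h4 : HasFDerivAt (fun y : EuclideanSpace ℝ (Fin d) => y i * A y j) _ x := h3.mul h2
    rw [h4.fderiv]
    simp [mul_comm]
  have hzero : ∀ i j : Fin d, ∫ x in Metric.sphere (0 : EuclideanSpace ℝ (Fin d)) t,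
      (x i * fderiv ℝ A x (rotGen i j x) j + rotGen i j x i * A x j) ∂μH[(d : ℝ) - 1] = 0 :=
    fun i j => by
      rw [← sphere_integral_rotation ((d : ℝ) - 1) t O hO hSO
        (fun y : EuclideanSpace ℝ (Fin d) => y i * A y j) ?_ (rotGen i j) (rotGen_skew i j) hfin]
      · exact setIntegral_congr_fun hK.measurableSet fun x hx => (hfd i j x hx).symm
      · exact (EuclideanSpace.proj i : EuclideanSpace ℝ (Fin d) →L[ℝ] ℝ).contDiff.contDiffOn.mul
          ((EuclideanSpace.proj j : EuclideanSpace ℝ (Fin d) →L[ℝ] ℝ).contDiff.comp_contDiffOn hA)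
  have hcij : ∀ i j : Fin d, IntegrableOn (fun x : EuclideanSpace ℝ (Fin d) =>
      x i * fderiv ℝ A x (rotGen i j x) j + rotGen i j x i * A x j) (Metric.sphere 0 t)
      μH[(d : ℝ) - 1] := fun i j => hint <|
    ((hproj i continuousOn_id).mul
      (hproj j (hDc.clm_apply (rotGen i j).continuous.continuousOn))).add
      ((hproj i (rotGen i j).continuous.continuousOn).mul (hproj j hAc))
  have hsum : ∫ x in Metric.sphere (0 : EuclideanSpace ℝ (Fin d)) t, (1 / t ^ 2) *
      (∑ i : Fin d, ∑ j : Fin d,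
        (x i * fderiv ℝ A x (rotGen i j x) j + rotGen i j x i * A x j)) ∂μH[(d : ℝ) - 1] = 0 := by
    rw [integral_const_mul, integral_finset_sum _ fun i _ =>
      integrable_finset_sum _ fun j _ => hcij i j]
    rw [Finset.sum_eq_zero, mul_zero]
    intro i _
    rw [integral_finset_sum _ fun j _ => hcij i j]
    exact Finset.sum_eq_zero fun j _ => hzero i j
  rw [← hsum]
  refine setIntegral_congr_fun hK.measurableSet fun x hx => ?_
  have hx' : ‖x‖ = t := mem_sphere_zero_iff_norm.1 hx
  simp only
  rw [rot_sum_identity, hx']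
  field_simp
  ring
end

section
/- If A is a C¹ vector field on the annulus O = {r₁ < |v| < r₂} with A(v)·v = 0 for all v ∈ O, then ∫_{|ω|=t} (div A)(ω) dω = 0 for every t ∈ (r₁, r₂), and for any χ ∈ C¹(O), ∫_{|ω|=t} ∇χ(ω)·A(ω) dω + ∫_{|ω|=t} χ(ω) (div A)(ω) dω = 0. -/
open Real MeasureTheory RealInnerProductSpace

lemma aux_sphere_finite (n : ℕ) (t : ℝ) (ht : 0 < t) :
    μH[(n : ℝ)] (Metric.sphere (0 : EuclideanSpace ℝ (Fin (n+1))) t) < ⊤ := by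
  let P : Fin (n+1) → (Fin n → ℝ) → EuclideanSpace ℝ (Fin (n+1)) := fun i y =>
    WithLp.toLp 2 (i.insertNth (α := fun _ => ℝ) 1 y)
  let g : Fin (n+1) → ℝ → (Fin n → ℝ) → EuclideanSpace ℝ (Fin (n+1)) := fun i s y =>
    (s * ‖P i y‖⁻¹) • P i y
  have hP0 : ∀ i y, P i y ≠ 0 := by
    intro i y h
    have := congrArg (fun v : EuclideanSpace ℝ (Fin (n+1)) => v i) h
    simp [P] at this
  have hPc : ∀ i, ContDiff ℝ 1 (P i) := by
    intro i
    rw [contDiff_euclidean]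
    intro j
    rcases Fin.eq_self_or_eq_succAbove i j with rfl | ⟨k, rfl⟩
    · simpa [P] using contDiff_const
    · simp only [P, Fin.insertNth_apply_succAbove]
      fun_prop
  have hg : ∀ i s, ContDiff ℝ 1 (g i s) := by
    intro i s
    have h1 : ContDiff ℝ 1 fun y => ‖P i y‖ := (hPc i).norm ℝ (hP0 i)
    exact (contDiff_const.mul (h1.inv fun y => norm_ne_zero_iff.2 (hP0 i y))).smul (hPc i)
  let Q : Set (Fin n → ℝ) := Metric.closedBall 0 1
  have hQ : ∀ i s, μH[(n : ℝ)] (g i s '' Q) < ⊤ := by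
    intro i s
    obtain ⟨K, hK⟩ := (hg i s).contDiffOn.exists_lipschitzOnWith (s := Q) one_ne_zero
      (convex_closedBall _ _) (isCompact_closedBall _ _)
    refine (hK.hausdorffMeasure_image_le (by positivity)).trans_lt ?_
    refine ENNReal.mul_lt_top (ENNReal.rpow_lt_top_of_nonneg (by positivity) (by simp)) ?_
    have := hausdorffMeasure_pi_real (ι := Fin n)
    simp only [Fintype.card_fin] at this
    rw [this]
    exact (isCompact_closedBall _ _).measure_lt_top
  have hsub : Metric.sphere (0 : EuclideanSpace ℝ (Fin (n+1))) t ⊆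
      ⋃ i, (g i t '' Q ∪ g i (-t) '' Q) := by
    intro w hw
    have hwn : ‖w‖ = t := by simpa using hw
    obtain ⟨i, -, hi⟩ := Finset.exists_max_image Finset.univ (fun i => |w i|) ⟨0, Finset.mem_univ _⟩
    have hi0 : w i ≠ 0 := by
      intro h0
      have : w = 0 := by
        ext j
        have := hi j (Finset.mem_univ _)
        simpa [h0] using this
      rw [this] at hwn; simp at hwn; linarith
    let y : Fin n → ℝ := fun j => w (i.succAbove j) / w i
    have hy : y ∈ Q := by
      simp only [Q, mem_closedBall_zero_iff]
      rw [pi_norm_le_iff_of_nonneg zero_le_one]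
      intro j
      simp only [y, Real.norm_eq_abs, abs_div]
      rw [div_le_one (abs_pos.2 hi0)]
      exact hi _ (Finset.mem_univ _)
    have hPy : P i y = (w i)⁻¹ • w := by
      ext j
      rcases Fin.eq_self_or_eq_succAbove i j with rfl | ⟨k, rfl⟩
      · simp [P, hi0]
      · simp [P, y, div_eq_inv_mul]
    rw [Set.mem_iUnion]
    refine ⟨i, ?_⟩
    rcases lt_or_gt_of_ne hi0 with h | h
    · right
      refine ⟨y, hy, ?_⟩
      simp only [g, hPy, norm_smul, hwn, norm_inv, Real.norm_eq_abs, abs_of_neg h, smul_smul]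
      convert one_smul ℝ w using 2
      field_simp
    · left
      refine ⟨y, hy, ?_⟩
      simp only [g, hPy, norm_smul, hwn, norm_inv, Real.norm_eq_abs, abs_of_pos h, smul_smul]
      convert one_smul ℝ w using 2
      field_simp
  refine (measure_mono hsub).trans_lt ?_
  refine (measure_iUnion_le _).trans_lt ?_
  rw [tsum_fintype]
  refine ENNReal.sum_lt_top.2 fun i _ => ?_
  exact (measure_union_le _ _).trans_lt (ENNReal.add_lt_top.2 ⟨hQ _ _, hQ _ _⟩)

section
variable {E : Type*} [NormedAddCommGroup E] [InnerProductSpace ℝ E] [FiniteDimensional ℝ E]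

lemma aux_rot (e f : E) (he : ‖e‖ = 1) (hf : ‖f‖ = 1) (hef : ⟪e, f⟫ = 0) (θ : ℝ) :
    ∃ R : E ≃ₗᵢ[ℝ] E, ∀ v, R v = v + (cos θ - 1) • (⟪v, e⟫ • e + ⟪v, f⟫ • f)
      + sin θ • (⟪v, f⟫ • e - ⟪v, e⟫ • f) := by
  let L : E →ₗ[ℝ] E :=
    { toFun := fun v => v + (cos θ - 1) • (⟪v, e⟫ • e + ⟪v, f⟫ • f)
        + sin θ • (⟪v, f⟫ • e - ⟪v, e⟫ • f)
      map_add' := by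
        intro x y
        simp only [inner_add_left]
        module
      map_smul' := by
        intro c x
        simp only [inner_smul_left, RingHom.id_apply, conj_trivial]
        module }
  have hL : ∀ v, ‖L v‖ = ‖v‖ := by
    intro v
    have hee : ⟪e, e⟫ = 1 := by rw [real_inner_self_eq_norm_sq, he]; norm_num
    have hff : ⟪f, f⟫ = 1 := by rw [real_inner_self_eq_norm_sq, hf]; norm_num
    have hfe : ⟪f, e⟫ = 0 := by rw [real_inner_comm]; exact hef
    rw [← sq_eq_sq₀ (norm_nonneg _) (norm_nonneg _), ← real_inner_self_eq_norm_sq,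
      ← real_inner_self_eq_norm_sq]
    simp only [L, LinearMap.coe_mk, AddHom.coe_mk, inner_add_left, inner_add_right, inner_sub_left,
      inner_sub_right, inner_smul_left, inner_smul_right, conj_trivial, hee, hff, hef, hfe,
      real_inner_comm v e, real_inner_comm v f]
    have h := Real.sin_sq_add_cos_sq θ
    linear_combination (⟪v, e⟫ ^ 2 + ⟪v, f⟫ ^ 2) * h
  exact ⟨(⟨L, hL⟩ : E →ₗᵢ[ℝ] E).toLinearIsometryEquiv rfl, fun v => rfl⟩

variable [MeasurableSpace E] [BorelSpace E]

lemma aux_rot_integral (s r₁ r₂ t : ℝ) (ht : t ∈ Set.Ioo r₁ r₂)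
    (hfin : μH[s] (Metric.sphere (0 : E) t) < ⊤)
    (e f : E) (he : ‖e‖ = 1) (hf : ‖f‖ = 1) (hef : ⟪e, f⟫ = 0) (φ : E → ℝ)
    (hφ : ContDiffOn ℝ 1 φ {v | r₁ < ‖v‖ ∧ ‖v‖ < r₂}) :
    ∫ ω in Metric.sphere (0 : E) t, fderiv ℝ φ ω (⟪ω, f⟫ • e - ⟪ω, e⟫ • f) ∂(μH[s]) = 0 := by
  have hO : IsOpen {v : E | r₁ < ‖v‖ ∧ ‖v‖ < r₂} :=
    (isOpen_lt continuous_const continuous_norm).inter (isOpen_lt continuous_norm continuous_const)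
  set S := Metric.sphere (0 : E) t with hS
  have hSO : S ⊆ {v : E | r₁ < ‖v‖ ∧ ‖v‖ < r₂} := by
    intro v hv
    have : ‖v‖ = t := by simpa [hS] using hv
    simpa [this] using ht
  have hSc : IsCompact S := isCompact_sphere _ _
  have : IsFiniteMeasure (μH[s].restrict S : Measure E) := ⟨by simpa using hfin⟩
  choose R hR using aux_rot e f he hf hef
  have hRS : ∀ θ, ∀ v ∈ S, R θ v ∈ S := by
    intro θ v hv
    simpa [hS] using hv
  set L : E → E := fun w => ⟪w, f⟫ • e - ⟪w, e⟫ • f with hL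
  have hLc : Continuous L := by fun_prop
  have hgc : ContinuousOn (fun w => fderiv ℝ φ w (L w)) S :=
    ((hφ.continuousOn_fderiv_of_isOpen hO le_rfl).mono hSO).clm_apply hLc.continuousOn
  obtain ⟨C, hC⟩ := hSc.exists_bound_of_continuousOn hgc
  have hder : ∀ v ∈ S, ∀ θ, HasDerivAt (fun θ => φ (R θ v)) (fderiv ℝ φ (R θ v) (L (R θ v))) θ := by
    intro v hv θ
    have h1 : DifferentiableAt ℝ φ (R θ v) :=
      (hφ.differentiableOn one_ne_zero).differentiableAt (hO.mem_nhds (hSO (hRS θ v hv)))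
    refine h1.hasFDerivAt.comp_hasDerivAt θ ?_
    have hee : ⟪e, e⟫ = 1 := by rw [real_inner_self_eq_norm_sq, he]; norm_num
    have hff : ⟪f, f⟫ = 1 := by rw [real_inner_self_eq_norm_sq, hf]; norm_num
    have hfe : ⟪f, e⟫ = 0 := by rw [real_inner_comm]; exact hef
    have h2 : HasDerivAt (fun θ => R θ v) ((-sin θ) • (⟪v, e⟫ • e + ⟪v, f⟫ • f)
        + cos θ • (⟪v, f⟫ • e - ⟪v, e⟫ • f)) θ := by
      simp only [hR]
      exact ((((Real.hasDerivAt_cos θ).sub_const 1).smul_const _).const_add v).add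
        ((Real.hasDerivAt_sin θ).smul_const _)
    convert h2 using 1
    simp only [hL, hR, inner_add_left, inner_sub_left, inner_smul_left, conj_trivial, hee, hff,
      hef, hfe]
    module
  have hmS : MeasurableSet S := hSc.measurableSet
  have hφc : ContinuousOn φ S := hφ.continuousOn.mono hSO
  have hmeas : ∀ h : E → ℝ, ContinuousOn h S → AEStronglyMeasurable h (μH[s].restrict S) :=
    fun h hh => hh.aestronglyMeasurable hmS
  have hR0 : ∀ v, R 0 v = v := by intro v; simp [hR]
  have key := hasDerivAt_integral_of_dominated_loc_of_deriv_le (μ := μH[s].restrict S)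
    (F := fun θ v => φ (R θ v)) (F' := fun θ v => fderiv ℝ φ (R θ v) (L (R θ v)))
    (x₀ := (0:ℝ)) (s := Set.univ) (bound := fun _ => C) Filter.univ_mem
    (Filter.Eventually.of_forall fun θ => hmeas _
      (hφc.comp (R θ).continuous.continuousOn (hRS θ)))
    (by
      simp only [hR0]
      obtain ⟨C', hC'⟩ := hSc.exists_bound_of_continuousOn hφc
      exact Integrable.of_bound (hmeas _ hφc) C' ((ae_restrict_iff' hmS).2 (.of_forall hC')))
    (by simp only [hR0]; exact hmeas _ hgc)
    ((ae_restrict_iff' hmS).2 (.of_forall fun v hv θ _ => hC _ (hRS θ v hv)))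
    (integrable_const _)
    ((ae_restrict_iff' hmS).2 (.of_forall fun v hv θ _ => hder v hv θ))
  have hconst : (fun θ => ∫ v in S, φ (R θ v) ∂(μH[s])) = fun _ => ∫ v in S, φ v ∂(μH[s]) := by
    funext θ
    have h := ((R θ).toIsometryEquiv.measurePreserving_hausdorffMeasure s).setIntegral_preimage_emb
      (R θ).toIsometryEquiv.toHomeomorph.measurableEmbedding φ S
    have hpre : (R θ).toIsometryEquiv ⁻¹' S = S := by
      ext v; simp [hS]
    rw [hpre] at h
    exact h
  have h2 := key.2
  rw [hconst] at h2
  have h3 := h2.unique (hasDerivAt_const _ _)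
  simpa only [hR0] using h3
end

lemma aux_annulus_open {E : Type*} [NormedAddCommGroup E] (r₁ r₂ : ℝ) :
    IsOpen {v : E | r₁ < ‖v‖ ∧ ‖v‖ < r₂} :=
  (isOpen_lt continuous_const continuous_norm).inter (isOpen_lt continuous_norm continuous_const)

lemma aux_div_continuousOn (d : ℕ) (r₁ r₂ : ℝ)
    (A : EuclideanSpace ℝ (Fin d) → EuclideanSpace ℝ (Fin d))
    (hA : ContDiffOn ℝ 1 A {v : EuclideanSpace ℝ (Fin d) | r₁ < ‖v‖ ∧ ‖v‖ < r₂}) :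
    ContinuousOn (fun ω => ∑ i : Fin d, fderiv ℝ A ω (EuclideanSpace.single i 1) i)
      {v : EuclideanSpace ℝ (Fin d) | r₁ < ‖v‖ ∧ ‖v‖ < r₂} := by
  refine continuousOn_finsetSum _ fun i _ => ?_
  have h1 := (hA.continuousOn_fderiv_of_isOpen (aux_annulus_open r₁ r₂) le_rfl).clm_apply
    (continuousOn_const (c := EuclideanSpace.single i (1:ℝ)))
  exact (EuclideanSpace.proj (𝕜 := ℝ) i).continuous.comp_continuousOn h1

lemma aux_integrableOn (d : ℕ) (s r₁ r₂ t : ℝ) (ht : t ∈ Set.Ioo r₁ r₂)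
    (hfin : μH[s] (Metric.sphere (0 : EuclideanSpace ℝ (Fin d)) t) < ⊤)
    (h : EuclideanSpace ℝ (Fin d) → ℝ)
    (hh : ContinuousOn h {v : EuclideanSpace ℝ (Fin d) | r₁ < ‖v‖ ∧ ‖v‖ < r₂}) :
    IntegrableOn h (Metric.sphere (0 : EuclideanSpace ℝ (Fin d)) t) (μH[s]) := by
  have hSc : IsCompact (Metric.sphere (0 : EuclideanSpace ℝ (Fin d)) t) := isCompact_sphere _ _
  have hc : ContinuousOn h (Metric.sphere (0 : EuclideanSpace ℝ (Fin d)) t) := by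
    refine hh.mono fun v hv => ?_
    have : ‖v‖ = t := by simpa using hv
    simpa [this] using ht
  have : IsFiniteMeasure (μH[s].restrict (Metric.sphere (0 : EuclideanSpace ℝ (Fin d)) t)) :=
    ⟨by simpa using hfin⟩
  obtain ⟨C, hC⟩ := hSc.exists_bound_of_continuousOn hc
  exact Integrable.of_bound (hc.aestronglyMeasurable hSc.measurableSet) C
    ((ae_restrict_iff' hSc.measurableSet).2 (.of_forall hC))

lemma aux_div_integral (d : ℕ) (s r₁ r₂ t : ℝ) (h12 : 0 < r₁) (ht : t ∈ Set.Ioo r₁ r₂)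
    (hfin : μH[s] (Metric.sphere (0 : EuclideanSpace ℝ (Fin d)) t) < ⊤)
    (A : EuclideanSpace ℝ (Fin d) → EuclideanSpace ℝ (Fin d))
    (hA : ContDiffOn ℝ 1 A {v : EuclideanSpace ℝ (Fin d) | r₁ < ‖v‖ ∧ ‖v‖ < r₂})
    (htang : ∀ v : EuclideanSpace ℝ (Fin d), r₁ < ‖v‖ → ‖v‖ < r₂ → ⟪A v, v⟫ = 0) :
    (∫ ω in Metric.sphere (0 : EuclideanSpace ℝ (Fin d)) t,
          (∑ i : Fin d, fderiv ℝ A ω (EuclideanSpace.single i 1) i) ∂(μH[s])) = 0 := by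
  set O := {v : EuclideanSpace ℝ (Fin d) | r₁ < ‖v‖ ∧ ‖v‖ < r₂} with hOdef
  have hO : IsOpen O := aux_annulus_open r₁ r₂
  let x : Fin d → EuclideanSpace ℝ (Fin d) → ℝ := fun i v => v i
  let e : Fin d → EuclideanSpace ℝ (Fin d) := fun i => EuclideanSpace.single i 1
  let B : Fin d → Fin d → EuclideanSpace ℝ (Fin d) → ℝ := fun i j v =>
    (A v i * v j - A v j * v i) / ‖v‖ ^ 2
  have hx : ∀ i, ContDiff ℝ 1 (x i) := fun i => (EuclideanSpace.proj (𝕜 := ℝ) i).contDiff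
  have hAi : ∀ i, ContDiffOn ℝ 1 (fun v => A v i) O := fun i =>
    (EuclideanSpace.proj (𝕜 := ℝ) i).contDiff.comp_contDiffOn hA
  have hB : ∀ i j, ContDiffOn ℝ 1 (B i j) O := by
    intro i j
    refine (((hAi i).mul (hx j).contDiffOn).sub ((hAi j).mul (hx i).contDiffOn)).div
      (contDiff_norm_sq ℝ).contDiffOn ?_
    intro v hv
    have : 0 < ‖v‖ := h12.trans hv.1
    positivity
  let L : Fin d → Fin d → EuclideanSpace ℝ (Fin d) → EuclideanSpace ℝ (Fin d) :=
    fun i j ω => ⟪ω, e j⟫ • e i - ⟪ω, e i⟫ • e j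
  have hLv : ∀ i j ω, L i j ω = ω j • e i - ω i • e j := by
    intro i j ω
    simp [L, e, EuclideanSpace.inner_single_right]
  have hint0 : ∀ i j, ∫ ω in Metric.sphere (0 : EuclideanSpace ℝ (Fin d)) t,
      fderiv ℝ (B i j) ω (L i j ω) ∂(μH[s]) = 0 := by
    intro i j
    by_cases hij : i = j
    · subst hij
      simp [L]
    · exact aux_rot_integral s r₁ r₂ t ht hfin (e i) (e j) (by simp [e]) (by simp [e])
        (by simp [e, EuclideanSpace.inner_single_right, hij, Ne.symm hij]) (B i j) (hB i j)
  have hintB : ∀ i j, IntegrableOn (fun ω => fderiv ℝ (B i j) ω (L i j ω))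
      (Metric.sphere (0 : EuclideanSpace ℝ (Fin d)) t) (μH[s]) := by
    intro i j
    refine aux_integrableOn d s r₁ r₂ t ht hfin _ ?_
    refine ((hB i j).continuousOn_fderiv_of_isOpen hO le_rfl).clm_apply ?_
    exact Continuous.continuousOn (by fun_prop)
  have hpt : ∀ ω ∈ O, (∑ i : Fin d, fderiv ℝ A ω (EuclideanSpace.single i 1) i)
      = (1/2) * ∑ i, ∑ j, fderiv ℝ (B i j) ω (L i j ω) := by
    intro ω hω
    have hn := hO.mem_nhds hω
    have hBd : ∀ i j, HasFDerivAt (B i j) (fderiv ℝ (B i j) ω) ω := fun i j =>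
      (((hB i j).differentiableOn one_ne_zero).differentiableAt hn).hasFDerivAt
    have hAd : HasFDerivAt A (fderiv ℝ A ω) ω :=
      ((hA.differentiableOn one_ne_zero).differentiableAt hn).hasFDerivAt
    have hanti : ∀ i j, fderiv ℝ (B j i) ω = - fderiv ℝ (B i j) ω := by
      intro i j
      have : B j i = - B i j := by
        funext v; simp only [B, Pi.neg_apply]; ring
      rw [this, fderiv_neg]
    have hAe : ∀ i, (fun v => A v i) =ᶠ[nhds ω] fun v => ∑ j, B i j v * x j v := by
      intro i
      filter_upwards [hn] with v hv
      have hv0 : 0 < ‖v‖ := h12.trans hv.1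
      have h0 : ∑ j, A v j * v j = 0 := by
        have := htang v hv.1 hv.2
        rw [PiLp.inner_apply] at this
        simpa [mul_comm] using this
      have h1 : ∑ j, v j * v j = ‖v‖ ^ 2 := by
        rw [EuclideanSpace.norm_sq_eq]
        simp [sq]
      have h2 : ∑ j, B i j v * x j v
          = (A v i * ∑ j, v j * v j - v i * ∑ j, A v j * v j) / ‖v‖ ^ 2 := by
        rw [Finset.mul_sum, Finset.mul_sum, ← Finset.sum_sub_distrib, Finset.sum_div]
        refine Finset.sum_congr rfl fun j _ => ?_
        simp only [B, x]; ring
      rw [h2, h0, h1]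
      field_simp
      simp
    have hder : ∀ i, fderiv ℝ A ω (e i) i = ∑ j, (B i j ω * (e i) j
        + ω j * fderiv ℝ (B i j) ω (e i)) := by
      intro i
      have h1 : HasFDerivAt (fun v => A v i)
          ((EuclideanSpace.proj (𝕜 := ℝ) i).comp (fderiv ℝ A ω)) ω :=
        (EuclideanSpace.proj (𝕜 := ℝ) i).hasFDerivAt.comp ω hAd
      have h2 : HasFDerivAt (fun v => ∑ j, B i j v * x j v)
          (∑ j, (B i j ω • (EuclideanSpace.proj (𝕜 := ℝ) j : EuclideanSpace ℝ (Fin d) →L[ℝ] ℝ)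
            + x j ω • fderiv ℝ (B i j) ω)) ω :=
        HasFDerivAt.fun_sum fun j _ =>
          (hBd i j).mul (EuclideanSpace.proj (𝕜 := ℝ) j).hasFDerivAt
      have h3 := h1.unique (h2.congr_of_eventuallyEq (hAe i))
      have h4 := congrArg (fun T : EuclideanSpace ℝ (Fin d) →L[ℝ] ℝ => T (e i)) h3
      simpa [ContinuousLinearMap.sum_apply, x] using h4
    have hdiag : ∀ i j, B i j ω * (e i) j = 0 := by
      intro i j
      by_cases hij : j = i
      · subst hij; simp [B]
      · simp [e, hij]
    have hsum : (∑ i : Fin d, fderiv ℝ A ω (e i) i)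
        = ∑ i, ∑ j, ω j * fderiv ℝ (B i j) ω (e i) := by
      refine Finset.sum_congr rfl fun i _ => ?_
      rw [hder i]
      exact Finset.sum_congr rfl fun j _ => by rw [hdiag, zero_add]
    have hswap : ∑ i, ∑ j, ω j * fderiv ℝ (B i j) ω (e i)
        = ∑ i, ∑ j, - (ω i * fderiv ℝ (B i j) ω (e j)) := by
      rw [Finset.sum_comm]
      refine Finset.sum_congr rfl fun i _ => Finset.sum_congr rfl fun j _ => ?_
      rw [hanti i j]; simp
    have hfinal : ∑ i, ∑ j, fderiv ℝ (B i j) ω (L i j ω)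
        = ∑ i, ∑ j, ω j * fderiv ℝ (B i j) ω (e i)
          + ∑ i, ∑ j, - (ω i * fderiv ℝ (B i j) ω (e j)) := by
      simp only [← Finset.sum_add_distrib]
      refine Finset.sum_congr rfl fun i _ => Finset.sum_congr rfl fun j _ => ?_
      rw [hLv, map_sub, map_smul, map_smul, smul_eq_mul, smul_eq_mul, sub_eq_add_neg]
    change (∑ i : Fin d, fderiv ℝ A ω (e i) i) = _
    rw [hfinal, ← hswap, hsum]
    ring
  rw [setIntegral_congr_fun (g := fun ω => (1/2) * ∑ i, ∑ j, fderiv ℝ (B i j) ω (L i j ω))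
    (isCompact_sphere _ _).measurableSet]
  · rw [integral_const_mul, integral_finsetSum _ fun i _ => integrable_finsetSum _ fun j _ => hintB i j]
    rw [Finset.sum_eq_zero, mul_zero]
    intro i _
    rw [integral_finsetSum _ fun j _ => hintB i j]
    exact Finset.sum_eq_zero fun j _ => hint0 i j
  · intro v hv
    refine hpt v ?_
    have : ‖v‖ = t := by simpa using hv
    simpa [hOdef, this] using ht

/-- If `A` is a `C¹` tangential vector field on the annulus (`A(v)·v = 0`), then the
integral of `div A` over each sphere `|ω| = t` vanishes, and for any `C¹` function `χ`,
`∫ ∇χ·A dω + ∫ χ div A dω = 0`. -/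
theorem tangential_field_sphere_integrals (d : ℕ) (hd : 2 ≤ d) (r₁ r₂ : ℝ) (h12 : 0 < r₁)
    (hlt : r₁ < r₂)
    (A : EuclideanSpace ℝ (Fin d) → EuclideanSpace ℝ (Fin d))
    (hA : ContDiffOn ℝ 1 A {v : EuclideanSpace ℝ (Fin d) | r₁ < ‖v‖ ∧ ‖v‖ < r₂})
    (htang : ∀ v : EuclideanSpace ℝ (Fin d), r₁ < ‖v‖ → ‖v‖ < r₂ → ⟪A v, v⟫ = 0) :
    ∀ t ∈ Set.Ioo r₁ r₂,
      ((∫ ω in Metric.sphere (0 : EuclideanSpace ℝ (Fin d)) t,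
          (∑ i : Fin d, fderiv ℝ A ω (EuclideanSpace.single i 1) i)
          ∂(μH[(d : ℝ) - 1])) = 0) ∧
      ∀ χ : EuclideanSpace ℝ (Fin d) → ℝ,
        ContDiffOn ℝ 1 χ {v : EuclideanSpace ℝ (Fin d) | r₁ < ‖v‖ ∧ ‖v‖ < r₂} →
        (∫ ω in Metric.sphere (0 : EuclideanSpace ℝ (Fin d)) t,
            fderiv ℝ χ ω (A ω) ∂(μH[(d : ℝ) - 1])) +
        (∫ ω in Metric.sphere (0 : EuclideanSpace ℝ (Fin d)) t,
            χ ω * (∑ i : Fin d, fderiv ℝ A ω (EuclideanSpace.single i 1) i)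
            ∂(μH[(d : ℝ) - 1])) = 0 := by
  intro t ht
  have hfin : μH[(d : ℝ) - 1] (Metric.sphere (0 : EuclideanSpace ℝ (Fin d)) t) < ⊤ := by
    obtain ⟨n, rfl⟩ : ∃ n, d = n + 1 := ⟨d - 1, by omega⟩
    have := aux_sphere_finite n t (h12.trans ht.1)
    simpa using this
  refine ⟨aux_div_integral d _ r₁ r₂ t h12 ht hfin A hA htang, ?_⟩
  intro χ hχ
  have hO := aux_annulus_open (E := EuclideanSpace ℝ (Fin d)) r₁ r₂
  have h := aux_div_integral d _ r₁ r₂ t h12 ht hfin (fun v => χ v • A v) (hχ.smul hA)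
    (by
      intro v h1 h2
      rw [inner_smul_left, htang v h1 h2, mul_zero])
  rw [← integral_add
    (aux_integrableOn d _ r₁ r₂ t ht hfin _
      ((hχ.continuousOn_fderiv_of_isOpen hO le_rfl).clm_apply hA.continuousOn))
    (aux_integrableOn d _ r₁ r₂ t ht hfin
      (fun ω => χ ω * ∑ i : Fin d, fderiv ℝ A ω (EuclideanSpace.single i 1) i)
      (hχ.continuousOn.mul (aux_div_continuousOn d r₁ r₂ A hA))), ← h]
  refine setIntegral_congr_fun (isCompact_sphere _ _).measurableSet ?_
  intro ω hω
  have hωn : ‖ω‖ = t := by simpa using hω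
  have hn := hO.mem_nhds (show ω ∈ {v : EuclideanSpace ℝ (Fin d) | r₁ < ‖v‖ ∧ ‖v‖ < r₂} by
    simpa [hωn] using ht)
  have hAd := (hA.differentiableOn one_ne_zero).differentiableAt hn
  have hχd := (hχ.differentiableOn one_ne_zero).differentiableAt hn
  have hsm := (hχd.hasFDerivAt.smul hAd.hasFDerivAt).fderiv
  have hAω : A ω = ∑ i, A ω i • EuclideanSpace.single i (1:ℝ) := by
    ext j
    simp [Finset.sum_apply, Pi.single_apply]
  have hl : fderiv ℝ χ ω (A ω) = ∑ i, A ω i * fderiv ℝ χ ω (EuclideanSpace.single i (1:ℝ)) := by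
    conv_lhs => rw [hAω]
    simp [map_sum]
  change fderiv ℝ χ ω (A ω) + χ ω * (∑ i : Fin d, fderiv ℝ A ω (EuclideanSpace.single i 1) i)
    = ∑ i : Fin d, fderiv ℝ (χ • A) ω (EuclideanSpace.single i 1) i
  rw [hsm, hl, Finset.mul_sum, ← Finset.sum_add_distrib]
  refine Finset.sum_congr rfl fun i _ => ?_
  simp
  ring
end
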